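/- Let U = (z₂, w₀, z₄, w₂) : [τ₀, ∞) → ℝ⁴ be continuously differentiable with U′(τ) = F₂(U(τ)) for all τ ≥ τ₀, and suppose (z₂(τ), w₀(τ)) → (0, 1) as τ → ∞. Then (z₄(τ), w₂(τ)) → (0, 0) as τ → ∞; moreover there exist C > 0 and τ₁ ≥ τ₀ such that for all τ ≥ τ₁: |z₄(τ)| ≤ C·(1 + τ)·e^{−τ} and |w₂(τ)| ≤ C·(1 + τ)·e^{−τ}. That is, convergence to the Minkowski rest point at leading order forces convergence to the Minkowski rest point M₄ = (0,1,0,0) at second order, with the decay rates of Theorem 7. -/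

import Mathlib

open Real Set Filter

/-- A Grönwall estimate with exponentially decaying rate: if `V ≥ 0` satisfies
`V' ≤ K e^{-τ/4} V + B` on `[T, ∞)`, then `V` grows at most linearly, with slope
proportional to `B`. -/
lemma exists_bound_of_deriv_le {V V' : ℝ → ℝ} {T K B : ℝ} (hT : 0 ≤ T) (hK : 0 ≤ K)
    (hB : 0 ≤ B) (hV : ∀ t ≥ T, HasDerivAt V (V' t) t) (hV0 : ∀ t ≥ T, 0 ≤ V t)
    (hle : ∀ t ≥ T, V' t ≤ K * exp (-t / 4) * V t + B) :
    ∃ C > 0, ∀ t ≥ T, V t ≤ C * (1 + B * t) := by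
  set G : ℝ → ℝ := fun t => exp (4 * K * exp (-t / 4)) with hG
  have hG1 : ∀ t, 1 ≤ G t := fun t => one_le_exp (by positivity)
  have hG2 : ∀ t ≥ T, G t ≤ exp (4 * K) := fun t ht => by
    refine exp_le_exp.2 (mul_le_of_le_one_right (by positivity) ?_)
    exact exp_le_one_iff.2 (by linarith)
  have hGd : ∀ t, HasDerivAt G (G t * (-(K * exp (-t / 4)))) t := fun t => by
    have h : HasDerivAt (fun t : ℝ => -t / 4) (-1 / 4) t := (hasDerivAt_id t).neg.div_const 4
    convert (h.exp.const_mul (4 * K)).exp using 1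
    ring
  have hW : ∀ t ≥ T, HasDerivAt (fun t => V t * G t - B * exp (4 * K) * t)
      (V' t * G t + V t * (G t * (-(K * exp (-t / 4)))) - B * exp (4 * K) * 1) t :=
    fun t ht => ((hV t ht).mul (hGd t)).sub ((hasDerivAt_id t).const_mul _)
  have hanti : AntitoneOn (fun t => V t * G t - B * exp (4 * K) * t) (Ici T) := by
    refine antitoneOn_of_deriv_nonpos (convex_Ici T)
      (fun t ht => (hW t ht).continuousAt.continuousWithinAt)
      (fun t ht => (hW t (interior_subset ht)).differentiableAt.differentiableWithinAt)
      fun t ht => ?_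
    have ht := interior_subset ht
    rw [(hW t ht).deriv]
    have h1 := mul_le_mul_of_nonneg_right (hle t ht) (zero_le_one.trans (hG1 t))
    have h2 := mul_le_mul_of_nonneg_left (hG2 t ht) hB
    linarith
  refine ⟨V T * G T + exp (4 * K), ?_, fun t ht => ?_⟩
  · exact add_pos_of_nonneg_of_pos
      (mul_nonneg (hV0 T le_rfl) (zero_le_one.trans (hG1 T))) (exp_pos _)
  have h1 : V t * G t - B * exp (4 * K) * t ≤ V T * G T - B * exp (4 * K) * T :=
    hanti self_mem_Ici ht ht
  have h2 : V t ≤ V t * G t := le_mul_of_one_le_right (hV0 t ht) (hG1 t)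
  have h3 : 0 ≤ V T * G T * (B * t) :=
    mul_nonneg (mul_nonneg (hV0 T le_rfl) (zero_le_one.trans (hG1 T)))
      (mul_nonneg hB (hT.trans ht))
  have h4 : 0 ≤ B * exp (4 * K) * T := by positivity
  have h5 := exp_pos (4 * K)
  nlinarith

lemma hasDerivAt_exp_mul {f : ℝ → ℝ} {f' t : ℝ} (c : ℝ) (hf : HasDerivAt f f' t) :
    HasDerivAt (fun t => exp (c * t) * f t) (exp (c * t) * (c * f t + f')) t := by
  have h : HasDerivAt (fun t => c * t) (c * 1) t := (hasDerivAt_id t).const_mul c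
  exact (h.exp.mul hf).congr_deriv (by ring)

lemma abs_le_of_exp_mul_sq_le {c x C t : ℝ} (h : exp (2 * c * t) * x ^ 2 ≤ C) :
    |x| ≤ √C * exp (-(c * t)) := by
  have h1 : (exp (c * t) * x) ^ 2 ≤ C := by
    rw [mul_pow, ← exp_nat_mul]
    convert h using 3
    push_cast
    ring
  have h2 := abs_le_sqrt h1
  rw [abs_mul, abs_of_pos (exp_pos _)] at h2
  rw [exp_neg, ← div_eq_mul_inv, le_div_iff₀ (exp_pos _)]
  linarith

lemma two_mul_mul_le_of_abs_le {d M : ℝ} (x y : ℝ) (h : |d| ≤ M) :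
    -(2 * x * y * d) ≤ M * (x ^ 2 + y ^ 2) := by
  obtain ⟨h1, h2⟩ := abs_le.1 h
  nlinarith [mul_nonneg (sub_nonneg.2 h2) (sq_nonneg (x - y)),
    mul_nonneg (sub_nonneg.2 h1) (sq_nonneg (x + y))]

/-- Preliminary decay at half the linear rate of solutions of the order `n = 1` STV ODE that stay
close to the Minkowski rest point. -/
lemma exists_first_order_half_decay {T : ℝ} {z w : ℝ → ℝ} (hT : 0 ≤ T)
    (hz : ∀ t ≥ T, HasDerivAt z (2 * z t - 3 * z t * w t) t)
    (hw : ∀ t ≥ T, HasDerivAt w (-(1 / 6) * z t + w t - (w t) ^ 2) t)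
    (hclose : ∀ t ≥ T, |w t - 1| ≤ 1 / 12) :
    ∃ K ≥ 0, ∀ t ≥ T, |w t - 1| ≤ K * exp (-t / 2) := by
  obtain ⟨C, hC, h⟩ := exists_bound_of_deriv_le hT le_rfl le_rfl
    (fun t ht => hasDerivAt_exp_mul 1 (((hz t ht).pow 2).add (((hw t ht).sub_const 1).pow 2)))
    (fun t ht => by simp only [Pi.add_apply, Pi.pow_apply]; positivity) (fun t ht => by
      simp only [Pi.add_apply, Pi.pow_apply, zero_mul, zero_add]
      refine mul_nonpos_of_nonneg_of_nonpos (exp_pos _).le ?_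
      obtain ⟨h1, h2⟩ := abs_le.1 (hclose t ht)
      obtain ⟨y, hy⟩ : ∃ y, y = w t - 1 := ⟨_, rfl⟩
      rw [show w t = y + 1 by linarith] at h1 h2 ⊢
      norm_num
      nlinarith [mul_nonneg (sq_nonneg (z t)) (show 0 ≤ y + 1 / 12 by linarith),
        mul_nonneg (sq_nonneg y) (show 0 ≤ y + 1 / 12 by linarith),
        sq_nonneg (z t + y), sq_nonneg (z t), sq_nonneg y])
  refine ⟨√C, sqrt_nonneg _, fun t ht => ?_⟩
  have h1 := h t ht
  simp only [Pi.add_apply, Pi.pow_apply] at h1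
  rw [show -t / 2 = -(1 / 2 * t) by ring]
  refine abs_le_of_exp_mul_sq_le ?_
  rw [show 2 * (1 / 2) * t = 1 * t by ring]
  nlinarith [mul_nonneg (exp_pos (1 * t)).le (sq_nonneg (z t))]

/-- Decay of `z₂` at the linear rate, once `w₀ - 1` is known to decay exponentially. -/
lemma exists_z₂_decay {T K : ℝ} {z w : ℝ → ℝ} (hT : 0 ≤ T) (hK : 0 ≤ K)
    (hz : ∀ t ≥ T, HasDerivAt z (2 * z t - 3 * z t * w t) t)
    (hw : ∀ t ≥ T, |w t - 1| ≤ K * exp (-t / 4)) :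
    ∃ A ≥ 0, ∀ t ≥ T, |z t| ≤ A * exp (-t) := by
  obtain ⟨C, hC, h⟩ := exists_bound_of_deriv_le (K := 6 * K) hT (by positivity) le_rfl
    (fun t ht => hasDerivAt_exp_mul (2 * 1) ((hz t ht).pow 2))
    (fun t ht => by simp only [Pi.pow_apply]; positivity) (fun t ht => by
      simp only [Pi.pow_apply]
      have h1 := mul_nonneg (exp_pos (2 * 1 * t)).le (sq_nonneg (z t))
      have h2 := (abs_le.1 (hw t ht)).1
      norm_num at h1 ⊢
      nlinarith)
  refine ⟨√C, sqrt_nonneg _, fun t ht => ?_⟩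
  rw [show -t = -(1 * t) by ring]
  exact abs_le_of_exp_mul_sq_le (by simpa using h t ht)

/-- Decay of `z₄` at the linear rate. The energy `1 + (e^τ z₄)² + (e^{3τ/4} w₂)²` absorbs the
off-diagonal coupling of the linearization. -/
lemma exists_z₄_decay {T K A : ℝ} {z w z₄ w₂ : ℝ → ℝ} (hT : 0 ≤ T) (hK : 0 ≤ K) (hA : 0 ≤ A)
    (hz4 : ∀ t ≥ T, HasDerivAt z₄
      ((5 / 12) * (z t) ^ 2 * w t + 4 * z₄ t - 5 * w t * z₄ t - 5 * z t * w₂ t) t)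
    (hw2 : ∀ t ≥ T, HasDerivAt w₂
      (-(1 / 24) * (z t) ^ 2 + (1 / 4) * z t * (w t) ^ 2 - (1 / 10) * z₄ t
        + 3 * w₂ t - 4 * w t * w₂ t) t)
    (hw : ∀ t ≥ T, |w t - 1| ≤ K * exp (-t / 4)) (hz : ∀ t ≥ T, |z t| ≤ A * exp (-t))
    (hclose : ∀ t ≥ T, |w t - 1| ≤ 1 / 12) :
    ∃ C ≥ 0, ∀ t ≥ T, |z₄ t| ≤ C * exp (-t) := by
  obtain ⟨C, hC, h⟩ := exists_bound_of_deriv_le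
    (K := 10 * K + 10 * A + A ^ 2 + 8 * K + 1 + A + A ^ 2) hT (by positivity) le_rfl
    (fun t ht => ((hasDerivAt_exp_mul 1 (hz4 t ht)).pow 2).add
      (((hasDerivAt_exp_mul (3 / 4) (hw2 t ht)).pow 2).const_add 1))
    (fun t ht => by simp only [Pi.add_apply, Pi.pow_apply]; positivity) (fun t ht => by
      simp only [Pi.add_apply, Pi.pow_apply]
      have hs0 := exp_pos (-t / 4)
      have hs1 : exp (-t / 4) ≤ 1 := exp_le_one_iff.2 (by linarith)
      have hr0 := exp_pos (1 / 4 * t)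
      have e1 : exp (1 * t) = exp (1 / 4 * t) ^ 4 := by
        rw [← exp_nat_mul]; congr 1; push_cast; ring
      have e2 : exp (3 / 4 * t) = exp (1 / 4 * t) ^ 3 := by
        rw [← exp_nat_mul]; congr 1; push_cast; ring
      have e3 : exp (-t) = exp (-t / 4) ^ 4 := by
        rw [← exp_nat_mul]; congr 1; push_cast; ring
      have e4 : exp (1 / 4 * t) * exp (-t / 4) = 1 := by
        rw [← exp_add, show 1 / 4 * t + -t / 4 = 0 by ring, exp_zero]
      have hwt := hw t ht
      have hzt := hz t ht
      have hct := hclose t ht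
      rw [e3] at hzt
      rw [e1, e2]
      generalize exp (-t / 4) = s at *
      generalize exp (1 / 4 * t) = r at *
      have hs2 : s ^ 2 ≤ 1 := pow_le_one₀ hs0.le hs1
      have hs3 : s ^ 3 ≤ s := by nlinarith
      have hs4 : s ^ 4 ≤ s := by nlinarith
      have hw_abs : |w t| ≤ 2 := by
        rw [abs_le] at hct ⊢; constructor <;> linarith [hct.1, hct.2]
      have hw_sq : w t ^ 2 ≤ 4 := by nlinarith [abs_le.1 hw_abs]
      have d1 : |r * z t| ≤ A * s := by
        rw [abs_mul, abs_of_pos hr0]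
        calc r * |z t| ≤ r * (A * s ^ 4) := by gcongr
          _ = A * (r * s) * s ^ 3 := by ring
          _ ≤ A * s := by rw [e4, mul_one]; gcongr
      have d2 : |5 / 12 * (r ^ 4 * z t ^ 2) * w t| ≤ A ^ 2 * s := by
        rw [abs_mul, abs_of_nonneg (by positivity : 0 ≤ 5 / 12 * (r ^ 4 * z t ^ 2)),
          ← sq_abs (z t)]
        calc 5 / 12 * (r ^ 4 * |z t| ^ 2) * |w t|
            ≤ 5 / 12 * (r ^ 4 * (A * s ^ 4) ^ 2) * 2 := by gcongr
          _ = 5 / 6 * A ^ 2 * (r * s) ^ 4 * s ^ 4 := by ring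
          _ ≤ 1 * A ^ 2 * (r * s) ^ 4 * s := by
            rw [e4]; gcongr; norm_num
          _ = A ^ 2 * s := by rw [e4]; ring
      have d3 : |1 / 4 * w t ^ 2 * (r ^ 3 * z t)| ≤ A * s := by
        rw [abs_mul, abs_of_nonneg (by positivity : 0 ≤ 1 / 4 * w t ^ 2), abs_mul,
          abs_of_pos (pow_pos hr0 3)]
        calc 1 / 4 * w t ^ 2 * (r ^ 3 * |z t|)
            ≤ 1 / 4 * 4 * (r ^ 3 * (A * s ^ 4)) := by gcongr
          _ = A * (r * s) ^ 3 * s := by ring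
          _ = A * s := by rw [e4]; ring
      have d4 : |-(1 / 24) * (r ^ 3 * z t ^ 2)| ≤ A ^ 2 * s := by
        rw [abs_mul, abs_of_nonneg (by positivity : 0 ≤ r ^ 3 * z t ^ 2), ← sq_abs (z t)]
        calc |-(1 / 24 : ℝ)| * (r ^ 3 * |z t| ^ 2)
            ≤ 1 * (r ^ 3 * (A * s ^ 4) ^ 2) := by gcongr; norm_num
          _ = A ^ 2 * (r * s) ^ 3 * (s ^ 4 * s) := by ring
          _ ≤ A ^ 2 * (r * s) ^ 3 * (1 * s) := by gcongr; exact pow_le_one₀ hs0.le hs1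
          _ = A ^ 2 * s := by rw [e4]; ring
      have d5 : |-(1 / 10) * s| ≤ 1 / 2 * s := by
        rw [abs_mul, abs_of_pos hs0]; gcongr; norm_num
      have i1 := two_mul_mul_le_of_abs_le (r ^ 4 * z₄ t) (r ^ 4 * z₄ t) hwt
      have i2 := two_mul_mul_le_of_abs_le (r ^ 3 * w₂ t) (r ^ 3 * w₂ t) hwt
      have i3 := two_mul_mul_le_of_abs_le (r ^ 4 * z₄ t) (r ^ 3 * w₂ t) d1
      have i4 := two_mul_mul_le_of_abs_le (r ^ 4 * z₄ t) (-1) d2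
      have i5 := two_mul_mul_le_of_abs_le (r ^ 3 * w₂ t) (-1) d3
      have i6 := two_mul_mul_le_of_abs_le (r ^ 3 * w₂ t) (-1) d4
      have i7 := two_mul_mul_le_of_abs_le (r ^ 3 * w₂ t) (-(r ^ 4 * z₄ t)) d5
      have gap : 0 ≤ s * (r ^ 4 * z₄ t) ^ 2 * (8 * K + 6 * A + A ^ 2 + 1 / 2) +
          s * (r ^ 3 * w₂ t) ^ 2 * (10 * K + 5 * A + A ^ 2 + 1 / 2) +
          s * (18 * K + 10 * A + 1) + 1 / 2 * (r ^ 3 * w₂ t) ^ 2 := by positivity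
      norm_num
      linear_combination 5 * i1 + 4 * i2 + 5 * i3 + i4 + i5 + i6 + i7 + gap +
        1 / 5 * (r ^ 3 * w₂ t) * (r ^ 3 * z₄ t) * e4)
  refine ⟨√C, sqrt_nonneg _, fun t ht => ?_⟩
  have h1 := h t ht
  simp only [Pi.add_apply, Pi.pow_apply] at h1
  rw [show -t = -(1 * t) by ring]
  refine abs_le_of_exp_mul_sq_le ?_
  have e : exp (2 * 1 * t) = exp (1 * t) ^ 2 := by
    rw [← exp_nat_mul]; congr 1; push_cast; ring
  rw [e]
  nlinarith [sq_nonneg (exp (3 / 4 * t) * w₂ t)]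

/-- Decay of `w₂` at the linear rate with the secular factor `1 + τ`. -/
lemma exists_w₂_decay {T K A P : ℝ} {z w z₄ w₂ : ℝ → ℝ} (hT : 0 ≤ T) (hK : 0 ≤ K) (hA : 0 ≤ A)
    (hP : 0 ≤ P)
    (hw2 : ∀ t ≥ T, HasDerivAt w₂
      (-(1 / 24) * (z t) ^ 2 + (1 / 4) * z t * (w t) ^ 2 - (1 / 10) * z₄ t
        + 3 * w₂ t - 4 * w t * w₂ t) t)
    (hw : ∀ t ≥ T, |w t - 1| ≤ K * exp (-t / 4)) (hz : ∀ t ≥ T, |z t| ≤ A * exp (-t))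
    (hclose : ∀ t ≥ T, |w t - 1| ≤ 1 / 12) (hz4 : ∀ t ≥ T, |z₄ t| ≤ P * exp (-t)) :
    ∃ C ≥ 0, ∀ t ≥ T, |w₂ t| ≤ C * (1 + t) * exp (-t) := by
  have hpos : ∀ q : ℝ, 0 < 1 + q ^ 2 := fun q => by positivity
  obtain ⟨C, hC, h⟩ := exists_bound_of_deriv_le (K := 4 * K) (B := A ^ 2 + A + P) hT
    (by positivity) (by positivity)
    (fun t ht => (((hasDerivAt_exp_mul 1 (hw2 t ht)).pow 2).const_add 1).sqrt (hpos _).ne')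
    (fun t ht => sqrt_nonneg _) (fun t ht => by
      simp only [Pi.pow_apply]
      have hs0 := exp_pos (-t)
      have hs1 : exp (-t) ≤ 1 := exp_le_one_iff.2 (by linarith)
      have e4 : exp (1 * t) * exp (-t) = 1 := by
        rw [← exp_add, show 1 * t + -t = 0 by ring, exp_zero]
      have hwt := hw t ht
      have hzt := hz t ht
      have hct := hclose t ht
      have hz4t := hz4 t ht
      have hE0 := exp_pos (1 * t)
      generalize exp (-t / 4) = s at *
      generalize exp (1 * t) = E at *
      generalize exp (-t) = u at *
      have hw_sq : w t ^ 2 ≤ 4 := by nlinarith [abs_le.1 hct]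
      have scaled : ∀ {x M : ℝ}, |x| ≤ M * u → |E * x| ≤ M := fun {x M} hx => by
        rw [abs_mul, abs_of_pos hE0]
        calc E * |x| ≤ E * (M * u) := by gcongr
          _ = M := by linear_combination M * e4
      have d1 := scaled hzt
      have d2 := scaled hz4t
      have d3 : |z t| ≤ A := hzt.trans (mul_le_of_le_one_right hA hs1)
      have d4 : |1 / 4 * w t ^ 2 * (E * z t)| ≤ A := by
        rw [abs_mul, abs_of_nonneg (by positivity : 0 ≤ 1 / 4 * w t ^ 2)]
        nlinarith [abs_nonneg (E * z t)]
      have d5 : |E * z t * z t| ≤ A ^ 2 := by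
        rw [abs_mul, sq]; gcongr
      obtain ⟨d, hd⟩ : ∃ d, d = 1 / 4 * w t ^ 2 * (E * z t) - 1 / 24 * (E * z t * z t)
        - 1 / 10 * (E * z₄ t) := ⟨_, rfl⟩
      have hdB : |d| ≤ A ^ 2 + A + P := by
        rw [abs_le] at d2 d4 d5 ⊢
        constructor <;> nlinarith [sq_nonneg A]
      have hV2 := sq_sqrt (hpos (E * w₂ t)).le
      have hVq := abs_le_sqrt (show (E * w₂ t) ^ 2 ≤ 1 + (E * w₂ t) ^ 2 by linarith)
      have hV := sqrt_pos.2 (hpos (E * w₂ t))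
      generalize √(1 + (E * w₂ t) ^ 2) = V at *
      have hqd : E * w₂ t * d ≤ V * (A ^ 2 + A + P) :=
        (le_abs_self _).trans ((abs_mul _ _).trans_le (by gcongr))
      have hy := two_mul_mul_le_of_abs_le (E * w₂ t) (E * w₂ t) hwt
      have hKs : 0 ≤ K * s := (abs_nonneg _).trans hwt
      rw [div_le_iff₀ (by positivity)]
      norm_num
      linear_combination 4 * hy + 2 * hqd + 8 * hKs - 8 * K * s * hV2 - 2 * (E * w₂ t) * hd)
  refine ⟨C * (1 + (A ^ 2 + A + P)), by positivity, fun t ht => ?_⟩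
  have ht0 : 0 ≤ t := hT.trans ht
  have h1 : |exp (1 * t) * w₂ t| ≤ C * (1 + (A ^ 2 + A + P) * t) :=
    (abs_le_sqrt (by simp)).trans (h t ht)
  rw [abs_mul, abs_of_pos (exp_pos _), one_mul] at h1
  rw [exp_neg, ← div_eq_mul_inv, le_div_iff₀ (exp_pos _), mul_comm]
  refine h1.trans ?_
  have hb : 0 ≤ A ^ 2 + A + P := by positivity
  rw [mul_assoc]
  exact mul_le_mul_of_nonneg_left (by nlinarith) hC.le

/-- For solutions of the order `n = 2` STV ODE, convergence of `(z₂, w₀)` to the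
Minkowski values `(0, 1)` forces `(z₄, w₂) → (0, 0)`, with the decay rates of
Theorem 7 of the paper. -/
theorem second_order_decay_at_M4 (τ₀ : ℝ) (z₂ w₀ z₄ w₂ : ℝ → ℝ)
    (hz2 : ∀ τ ∈ Ici τ₀, HasDerivAt z₂ (2 * z₂ τ - 3 * z₂ τ * w₀ τ) τ)
    (hw0 : ∀ τ ∈ Ici τ₀, HasDerivAt w₀ (-(1 / 6) * z₂ τ + w₀ τ - (w₀ τ) ^ 2) τ)
    (hz4 : ∀ τ ∈ Ici τ₀, HasDerivAt z₄
      ((5 / 12) * (z₂ τ) ^ 2 * w₀ τ + 4 * z₄ τ - 5 * w₀ τ * z₄ τ - 5 * z₂ τ * w₂ τ) τ)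
    (hw2 : ∀ τ ∈ Ici τ₀, HasDerivAt w₂
      (-(1 / 24) * (z₂ τ) ^ 2 + (1 / 4) * z₂ τ * (w₀ τ) ^ 2 - (1 / 10) * z₄ τ
        + 3 * w₂ τ - 4 * w₀ τ * w₂ τ) τ)
    (hlim : Tendsto (fun τ => (z₂ τ, w₀ τ)) atTop (nhds ((0 : ℝ), (1 : ℝ)))) :
    Tendsto (fun τ => (z₄ τ, w₂ τ)) atTop (nhds ((0 : ℝ), (0 : ℝ))) ∧
    ∃ C > (0 : ℝ), ∃ τ₁ ≥ τ₀, ∀ τ ≥ τ₁,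
      |z₄ τ| ≤ C * (1 + τ) * Real.exp (-τ) ∧
      |w₂ τ| ≤ C * (1 + τ) * Real.exp (-τ) := by
  obtain ⟨-, hw1⟩ := (Prod.tendsto_iff _ _).1 hlim
  obtain ⟨T', hT'⟩ := eventually_atTop.1 (Metric.tendsto_nhds.1 hw1 (1 / 12) (by norm_num))
  obtain ⟨T, hT, hTτ, hTT'⟩ : ∃ T, 0 ≤ T ∧ τ₀ ≤ T ∧ T' ≤ T :=
    ⟨max 0 (max τ₀ T'), by simp, by simp, by simp⟩
  have hz2 := fun t (ht : t ≥ T) => hz2 t (hTτ.trans ht)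
  have hw0 := fun t (ht : t ≥ T) => hw0 t (hTτ.trans ht)
  have hz4 := fun t (ht : t ≥ T) => hz4 t (hTτ.trans ht)
  have hw2 := fun t (ht : t ≥ T) => hw2 t (hTτ.trans ht)
  have hclose : ∀ t ≥ T, |w₀ t - 1| ≤ 1 / 12 := fun t ht => (hT' t (hTT'.trans ht)).le
  obtain ⟨K, hK, hwK⟩ := exists_first_order_half_decay hT hz2 hw0 hclose
  have hwK : ∀ t ≥ T, |w₀ t - 1| ≤ K * exp (-t / 4) := fun t ht =>
    (hwK t ht).trans (mul_le_mul_of_nonneg_left (exp_le_exp.2 (by linarith)) hK)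
  obtain ⟨A, hA, hzA⟩ := exists_z₂_decay hT hK hz2 hwK
  obtain ⟨P, hP, hzP⟩ := exists_z₄_decay hT hK hA hz4 hw2 hwK hzA hclose
  obtain ⟨Q, hQ, hwQ⟩ := exists_w₂_decay hT hK hA hP hw2 hwK hzA hclose hzP
  have hbound : ∀ τ ≥ T, |z₄ τ| ≤ (P + Q + 1) * (1 + τ) * exp (-τ) ∧
      |w₂ τ| ≤ (P + Q + 1) * (1 + τ) * exp (-τ) := fun τ hτ => by
    have hτ0 : 0 ≤ τ := hT.trans hτ
    refine ⟨(hzP τ hτ).trans ?_, (hwQ τ hτ).trans ?_⟩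
    · exact mul_le_mul_of_nonneg_right (by nlinarith) (exp_pos _).le
    · exact mul_le_mul_of_nonneg_right (by nlinarith) (exp_pos _).le
  have hlim0 : Tendsto (fun τ => (P + Q + 1) * (1 + τ) * exp (-τ)) atTop (nhds 0) := by
    have h0 := tendsto_exp_neg_atTop_nhds_zero
    have h1 := tendsto_pow_mul_exp_neg_atTop_nhds_zero 1
    have h2 := (h0.add h1).const_mul (P + Q + 1)
    rw [add_zero, mul_zero] at h2
    exact h2.congr fun τ => by ring
  refine ⟨Tendsto.prodMk_nhds ?_ ?_, P + Q + 1, by positivity, T, hTτ, hbound⟩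
  · exact squeeze_zero_norm' (eventually_atTop.2 ⟨T, fun τ hτ => (hbound τ hτ).1⟩) hlim0
  · exact squeeze_zero_norm' (eventually_atTop.2 ⟨T, fun τ hτ => (hbound τ hτ).2⟩) hlim0
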